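/- arXiv:0709.4316 — 2 statements merged into one kernel-verified Lean document; each statement's English description precedes it below -/
import Mathlib

section
/- Let 0 < α < 1, w > 0 and θ ∈ ℝ. If c > 0 is such that the N(θ,1) probability of the set B(c,θ) equals 1 − α, then B(c,θ) is a nonempty bounded open interval: there exist real numbers a < b with B(c,θ) = (a, b). -/
open Real Set MeasureTheory ProbabilityTheory

/-- The standard normal density. -/
noncomputable def phi (x : ℝ) : ℝ := (Real.sqrt (2 * Real.pi))⁻¹ * Real.exp (-x ^ 2 / 2)

/-- `g(x, c, θ)` for a given weight `w`. -/
noncomputable def g (w x c θ : ℝ) : ℝ := (w + phi x) / phi (x - θ) - c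

/-- The set `B(c, θ) = {x : g(x, c, θ) < 0}` for a given weight `w`. -/
def B (w c θ : ℝ) : Set ℝ := {x : ℝ | g w x c θ < 0}

/-- The two exponents of the normal densities combine into a sum of two exponentials. -/
lemma g_eq (w x c θ : ℝ) :
    g w x c θ = w * √(2 * π) * exp ((x - θ) ^ 2 / 2) + exp (θ ^ 2 / 2 - x * θ) - c := by
  have hs : √(2 * π) ≠ 0 := by positivity
  have h₁ : exp (-(x - θ) ^ 2 / 2) * exp ((x - θ) ^ 2 / 2) = 1 := by
    rw [← exp_add, ← exp_zero]; ring_nf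
  have h₂ : exp (-(x - θ) ^ 2 / 2) * exp (θ ^ 2 / 2 - x * θ) = exp (-x ^ 2 / 2) := by
    rw [← exp_add]; ring_nf
  have hphi : phi (x - θ) ≠ 0 := by unfold phi; positivity
  rw [g, sub_left_inj, div_eq_iff hphi, phi, phi, ← h₂]
  rw [neg_div] at h₁
  field_simp
  linear_combination (-w * √(2 * π)) * h₁

lemma continuous_g (w c θ : ℝ) : Continuous fun x => g w x c θ := by
  simp only [g_eq]
  fun_prop

lemma ConvexOn.real_exp {f : ℝ → ℝ} {s : Set ℝ} (hf : ConvexOn ℝ s f) :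
    ConvexOn ℝ s fun x => exp (f x) := by
  refine ⟨hf.1, fun x hx y hy a b ha hb hab => ?_⟩
  exact (exp_le_exp.2 (hf.2 hx hy ha hb hab)).trans
    (convexOn_exp.2 (mem_univ _) (mem_univ _) ha hb hab)

lemma convexOn_g {w : ℝ} (hw : 0 ≤ w) (c θ : ℝ) : ConvexOn ℝ univ fun x => g w x c θ := by
  have hsq : ConvexOn ℝ univ fun x : ℝ => (x - θ) ^ 2 / 2 := by
    refine ⟨convex_univ, fun x _ y _ a b ha hb hab => ?_⟩
    obtain rfl : b = 1 - a := by linarith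
    simp only [smul_eq_mul]
    nlinarith [mul_nonneg (mul_nonneg ha hb) (sq_nonneg (x - y))]
  have hlin : ConvexOn ℝ univ fun x : ℝ => θ ^ 2 / 2 - x * θ := by
    refine ⟨convex_univ, fun x _ y _ a b ha hb hab => le_of_eq ?_⟩
    obtain rfl : b = 1 - a := by linarith
    simp only [smul_eq_mul]
    ring
  simp only [g_eq]
  have hK : 0 ≤ w * √(2 * π) := by positivity
  exact ((hsq.real_exp.smul hK).add hlin.real_exp).sub (concaveOn_const c convex_univ)

lemma isOpen_B (w c θ : ℝ) : IsOpen (B w c θ) :=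
  isOpen_lt (continuous_g w c θ) continuous_const

lemma convex_B {w : ℝ} (hw : 0 ≤ w) (c θ : ℝ) : Convex ℝ (B w c θ) := by
  simpa [B] using (convexOn_g hw c θ).convex_lt 0

lemma B_subset_Icc {w : ℝ} (hw : 0 < w) (c θ : ℝ) :
    B w c θ ⊆ Icc (θ - (1 + c / (w * √(2 * π)))) (θ + (1 + c / (w * √(2 * π)))) := by
  intro x hx
  have hK : 0 < w * √(2 * π) := by positivity
  have hlt : exp ((x - θ) ^ 2 / 2) < c / (w * √(2 * π)) := by
    rw [lt_div_iff₀' hK]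
    have hg : g w x c θ < 0 := hx
    rw [g_eq] at hg
    linarith [exp_pos (θ ^ 2 / 2 - x * θ)]
  have hexp := add_one_le_exp ((x - θ) ^ 2 / 2)
  constructor <;> nlinarith [sq_nonneg (x - θ - 1), sq_nonneg (x - θ + 1)]

/-- A nonempty bounded open convex set of reals is an open interval. -/
lemma Convex.exists_eq_Ioo {s : Set ℝ} (hs : Convex ℝ s) (ho : IsOpen s) (hne : s.Nonempty)
    (hb : BddBelow s) (ha : BddAbove s) : ∃ a b : ℝ, a < b ∧ s = Ioo a b := by
  have heq : s = Ioo (sInf s) (sSup s) := by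
    refine Subset.antisymm ?_ (IsConnected.Ioo_csInf_csSup_subset ⟨hne, hs.isPreconnected⟩ hb ha)
    rw [← interior_Icc]
    exact interior_maximal (subset_Icc_csInf_csSup hb ha) ho
  exact ⟨_, _, nonempty_Ioo.1 (heq ▸ hne), heq⟩

/-- let `0 < α < 1`, `w > 0` and `θ ∈ ℝ`. If `c > 0` is such that the `N(θ,1)`
probability of `B(c, θ)` equals `1 − α`, then `B(c, θ)` is a nonempty bounded open interval:
there exist `a < b` with `B(c, θ) = (a, b)`. -/
theorem stmt_4 (α w θ c : ℝ) (hα : 0 < α) (hα1 : α < 1) (hw : 0 < w) (hc : 0 < c)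
    (hcov : gaussianReal θ 1 (B w c θ) = ENNReal.ofReal (1 - α)) :
    ∃ a b : ℝ, a < b ∧ B w c θ = Set.Ioo a b := by
  have hne : (B w c θ).Nonempty := by
    rw [nonempty_iff_ne_empty]
    intro h
    rw [h, measure_empty, eq_comm, ENNReal.ofReal_eq_zero] at hcov
    linarith
  exact (convex_B hw.le c θ).exists_eq_Ioo (isOpen_B w c θ) hne
    (bddBelow_Icc.mono (B_subset_Icc hw c θ)) (bddAbove_Icc.mono (B_subset_Icc hw c θ))
end

section
/- (Neyman–Pearson-type optimality of the acceptance region.) Let 0 < α < 1, w ≥ 0 and θ ∈ ℝ, and suppose c > 0 is such that ∫_{B(c,θ)} φ(x − θ) dx = 1 − α. Then for every measurable set A ⊆ ℝ with ∫_A φ(x − θ) dx ≥ 1 − α, one has ∫_{B(c,θ)} (w + φ(x)) dx ≤ ∫_A (w + φ(x)) dx. -/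
open Real Set MeasureTheory

/-- Neyman–Pearson lemma: among all sets `t` with at least as much `h`-mass, the set `s`, on which
`f ≤ c * h` and off which `c * h ≤ f`, has the least `f`-mass. -/
theorem setLIntegral_le_of_neymanPearson {X : Type*} [MeasurableSpace X] {μ : Measure X}
    {f h : X → ENNReal} {c : ENNReal} {s t : Set X} (hh : Measurable h)
    (hs : MeasurableSet s) (ht : MeasurableSet t)
    (hle : ∀ x ∈ s, f x ≤ c * h x) (hge : ∀ x ∉ s, c * h x ≤ f x)
    (hfin : ∫⁻ x in s, h x ∂μ ≠ ⊤) (hst : ∫⁻ x in s, h x ∂μ ≤ ∫⁻ x in t, h x ∂μ) :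
    ∫⁻ x in s, f x ∂μ ≤ ∫⁻ x in t, f x ∂μ := by
  have hdiff : ∫⁻ x in s \ t, h x ∂μ ≤ ∫⁻ x in t \ s, h x ∂μ := by
    have hinter : ∫⁻ x in s ∩ t, h x ∂μ ≠ ⊤ :=
      ne_top_of_le_ne_top hfin (lintegral_mono_set inter_subset_left)
    rw [← lintegral_inter_add_sdiff h s ht, ← lintegral_inter_add_sdiff h t hs,
      inter_comm t s] at hst
    exact (ENNReal.add_le_add_iff_left hinter).1 hst
  rw [← lintegral_inter_add_sdiff f s ht, ← lintegral_inter_add_sdiff f t hs, inter_comm t s]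
  refine add_le_add_right ?_ _
  calc ∫⁻ x in s \ t, f x ∂μ ≤ ∫⁻ x in s \ t, c * h x ∂μ :=
        setLIntegral_mono' (hs.diff ht) fun x hx => hle x hx.1
    _ = c * ∫⁻ x in s \ t, h x ∂μ := lintegral_const_mul c hh
    _ ≤ c * ∫⁻ x in t \ s, h x ∂μ := by gcongr
    _ = ∫⁻ x in t \ s, c * h x ∂μ := (lintegral_const_mul c hh).symm
    _ ≤ ∫⁻ x in t \ s, f x ∂μ := setLIntegral_mono' (ht.diff hs) fun x hx => hge x hx.2

theorem phi_pos (x : ℝ) : 0 < phi x := by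
  unfold phi
  positivity

theorem measurable_phi : Measurable phi := by
  unfold phi
  fun_prop

theorem integrable_phi : Integrable phi := by
  have h : phi = ProbabilityTheory.gaussianPDFReal 0 1 := by
    ext x
    simp [phi, ProbabilityTheory.gaussianPDFReal]
  exact h ▸ ProbabilityTheory.integrable_gaussianPDFReal 0 1

theorem measurableSet_B (w c θ : ℝ) : MeasurableSet (B w c θ) := by
  have hg : Measurable fun x => g w x c θ :=
    ((measurable_phi.const_add w).div (measurable_phi.comp (measurable_id.sub_const θ))).sub_const c
  exact measurableSet_lt hg measurable_const

theorem mem_B_iff {w c θ x : ℝ} : x ∈ B w c θ ↔ w + phi x < c * phi (x - θ) := by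
  rw [B, mem_ofPred_eq, g, sub_neg, div_lt_iff₀ (phi_pos _)]

/-- Neyman–Pearson-type optimality of the acceptance region: let `0 < α < 1`,
`w ≥ 0` and `θ ∈ ℝ`, and suppose `c > 0` is such that `∫_{B(c,θ)} φ(x − θ) dx = 1 − α`.
Then for every measurable `A ⊆ ℝ` with `∫_A φ(x − θ) dx ≥ 1 − α`, one has
`∫_{B(c,θ)} (w + φ(x)) dx ≤ ∫_A (w + φ(x)) dx`. -/
theorem stmt_12 (α w θ c : ℝ) (hα : 0 < α) (hα1 : α < 1) (hw : 0 ≤ w) (hc : 0 < c)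
    (hB : ∫ x in B w c θ, phi (x - θ) = 1 - α)
    (A : Set ℝ) (hA : MeasurableSet A) (hAcov : 1 - α ≤ ∫ x in A, phi (x - θ)) :
    ∫⁻ x in B w c θ, ENNReal.ofReal (w + phi x) ≤
      ∫⁻ x in A, ENNReal.ofReal (w + phi x) := by
  have hmeas : Measurable fun x => phi (x - θ) := measurable_phi.comp (measurable_id.sub_const θ)
  have hint : Integrable fun x => phi (x - θ) := integrable_phi.comp_sub_right θ
  have hlint (s : Set ℝ) : ∫⁻ x in s, ENNReal.ofReal (phi (x - θ)) =
      ENNReal.ofReal (∫ x in s, phi (x - θ)) :=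
    (ofReal_integral_eq_lintegral_ofReal hint.integrableOn
      (ae_of_all _ fun x => (phi_pos (x - θ)).le)).symm
  refine setLIntegral_le_of_neymanPearson (c := ENNReal.ofReal c) hmeas.ennreal_ofReal
    (measurableSet_B w c θ) hA (fun x hx => ?_) (fun x hx => ?_) ?_ ?_
  · rw [← ENNReal.ofReal_mul hc.le]
    exact ENNReal.ofReal_le_ofReal (mem_B_iff.1 hx).le
  · rw [← ENNReal.ofReal_mul hc.le]
    exact ENNReal.ofReal_le_ofReal (not_lt.1 (mem_B_iff.not.1 hx))
  · rw [hlint]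
    exact ENNReal.ofReal_ne_top
  · rw [hlint, hlint]
    exact ENNReal.ofReal_le_ofReal (hB.trans_le hAcov)
end
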